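/- In the projective geometric algebra G_{n,0,1}, the projective join x ∨ y = (x* ∧ y*)^{−*} is equivariant to the sandwich action of Spin(n,0,1): for every u ∈ Spin(n,0,1) and all multivectors x, y, one has u[x ∨ y] = u[x] ∨ u[y]. -/

import Mathlib

open CliffordAlgebra

noncomputable section

/-- The quadratic form of the geometric algebra `G_{n,0,r}`: the first `n` coordinates are
orthogonal basis vectors `e_1, …, e_n` of square `+1`, while the remaining `r` coordinates
are degenerate directions of square `0` (when `r = 1`, the last coordinate is `e_0`). -/
def gaForm (n r : ℕ) : QuadraticForm ℝ (Fin (n + r) → ℝ) :=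
  QuadraticMap.weightedSumSquares ℝ (fun i : Fin (n + r) => if (i : ℕ) < n then (1 : ℝ) else 0)

/-- The geometric algebra `G_{n,0,r}`, as a real Clifford algebra. -/
abbrev GA (n r : ℕ) := CliffordAlgebra (gaForm n r)

/-- The `i`-th basis vector of the underlying quadratic space. -/
def gaBasisVec (n r : ℕ) (i : Fin (n + r)) : Fin (n + r) → ℝ := Pi.single i 1

/-- The `i`-th basis vector, embedded in the geometric algebra. -/
def eVec (n r : ℕ) (i : Fin (n + r)) : GA n r := ι (gaForm n r) (gaBasisVec n r i)

instance : Invertible (2 : ℝ) := invertibleOfNonzero two_ne_zero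

/-- The canonical linear equivalence with the exterior algebra (used to transport the
grading and the wedge product to the Clifford algebra). -/
def gaToExt (n r : ℕ) : GA n r ≃ₗ[ℝ] ExteriorAlgebra ℝ (Fin (n + r) → ℝ) :=
  CliffordAlgebra.equivExterior (gaForm n r)

/-- Grade-`k` projection `⟨x⟩_k` of a multivector, setting all non-grade-`k`
components to zero. -/
def gradeProj (n r : ℕ) (k : ℕ) : GA n r →ₗ[ℝ] GA n r :=
  (gaToExt n r).symm.toLinearMap ∘ₗ
    (GradedAlgebra.proj (fun i : ℕ => ⋀[ℝ]^i (Fin (n + r) → ℝ)) k) ∘ₗ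
      (gaToExt n r).toLinearMap

/-- Wedge (exterior) product of multivectors. -/
def wedge (n r : ℕ) (x y : GA n r) : GA n r :=
  (gaToExt n r).symm (gaToExt n r x * gaToExt n r y)

/-- The versor (geometric product of vectors) associated to a list of vectors. -/
def versor (n r : ℕ) (l : List (Fin (n + r) → ℝ)) : GA n r :=
  (l.map (ι (gaForm n r))).prod

/-- `IsUnitVecList n r l` : every vector in the list `l` is an (invertible) unit vector,
so that `versor n r l` is an element of the Pin group. -/
def IsUnitVecList (n r : ℕ) (l : List (Fin (n + r) → ℝ)) : Prop :=
  ∀ v ∈ l, gaForm n r v = 1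

/-- The sandwich action `u[x]` of the Pin-group element `u = v_1 ⋯ v_k` (presented by the
list `l = [v_1, …, v_k]` of unit vectors) on a multivector `x`: `u[x] = u x̂ u⁻¹` if `u` is
odd and `u[x] = u x u⁻¹` if `u` is even, where `x̂` is the grade involution and where
`u⁻¹ = ũ` (the reversal) for a product of unit vectors. -/
def pinAction (n r : ℕ) (l : List (Fin (n + r) → ℝ)) (x : GA n r) : GA n r :=
  versor n r l * ((⇑(involute (Q := gaForm n r)))^[l.length] x) * reverse (versor n r l)

/-- The blade (wedge product) determined by a list of vectors. -/
def bladeList (n r : ℕ) (vs : List (Fin (n + r) → ℝ)) : GA n r :=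
  vs.foldr (fun v acc => wedge n r (ι (gaForm n r) v) acc) 1

/-- `IsBlade n r k x` : `x` is a `k`-blade, i.e. a (scaled) wedge product of `k` vectors. -/
def IsBlade (n r : ℕ) (k : ℕ) (x : GA n r) : Prop :=
  ∃ (c : ℝ) (vs : List (Fin (n + r) → ℝ)), vs.length = k ∧ x = c • bladeList n r vs

/-- Scalar (grade-0) coefficient of a multivector. -/
def scalarCoeff (n r : ℕ) (x : GA n r) : ℝ :=
  ExteriorAlgebra.algebraMapInv (gaToExt n r x)

/-- Squared norm `‖x‖² = ⟨x x̃⟩₀` of a multivector. -/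
def gaNormSq (n r : ℕ) (x : GA n r) : ℝ :=
  scalarCoeff n r (x * reverse x)

/-- Norm `‖x‖ = √⟨x x̃⟩₀` of a multivector. -/
def gaNorm (n r : ℕ) (x : GA n r) : ℝ := Real.sqrt (gaNormSq n r x)

/-- Left contraction `v ⌋ x` of a multivector `x` by a vector `v`, defined gradewise by
`v ⌋ ⟨x⟩_l = ⟨ v ⟨x⟩_l ⟩_{l-1}`. -/
def vContr (n r : ℕ) (v : Fin (n + r) → ℝ) (x : GA n r) : GA n r :=
  ∑ l ∈ Finset.range (n + r + 1),
    gradeProj n r (l - 1) (ι (gaForm n r) v * gradeProj n r l x)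

/-- The Euclidean pseudoscalar `e_1 e_2 ⋯ e_n`, the geometric product of the
non-degenerate basis vectors. -/
def eucPseudoscalar (n r : ℕ) : GA n r :=
  (((List.finRange (n + r)).filter (fun i : Fin (n + r) => decide ((i : ℕ) < n))).map
    (eVec n r)).prod

/-- In `G_{n,0,1}`, the degenerate basis vector `e_0` (realized as the last coordinate). -/
def e0 (n : ℕ) : GA n 1 := eVec n 1 (Fin.last n)

/-- A vector of the quadratic space is Euclidean if it has no degenerate (`e_0`) component. -/
def IsEuclideanVec (n r : ℕ) (v : Fin (n + r) → ℝ) : Prop :=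
  ∀ i : Fin (n + r), n ≤ (i : ℕ) → v i = 0

/-- A multivector is Euclidean (contains no `e_0`) if it lies in the subalgebra generated
by the Euclidean vectors. -/
def IsEuclidean (n r : ℕ) (x : GA n r) : Prop :=
  x ∈ Algebra.adjoin ℝ {y : GA n r | ∃ v, IsEuclideanVec n r v ∧ y = ι (gaForm n r) v}

/-- In `G_{n,0,1}`, the pseudoscalar `e_0 e_1 ⋯ e_n`. -/
def pgaPseudoscalar (n : ℕ) : GA n 1 := e0 n * eucPseudoscalar n 1

/-- The basis blade associated to a set `S` of basis indices: the wedge product of the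
corresponding basis vectors, taken in increasing index order. -/
def basisBlade (n r : ℕ) (S : Finset (Fin (n + r))) : GA n r :=
  bladeList n r ((S.sort (· ≤ ·)).map (gaBasisVec n r))

/-- `IsProjDual n D` : `D` is the projective (right-complement) dual of `G_{n,0,1}`:
a linear bijection sending each basis `k`-blade `x` to the basis `(n+1-k)`-blade `x*`
built on the complementary indices, characterized by `x ∧ x* = e_0 e_1 ⋯ e_n`. -/
def IsProjDual (n : ℕ) (D : GA n 1 ≃ₗ[ℝ] GA n 1) : Prop :=
  ∀ S : Finset (Fin (n + 1)),
    (∃ c : ℝ, D (basisBlade n 1 S) = c • basisBlade n 1 Sᶜ) ∧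
      wedge n 1 (basisBlade n 1 S) (D (basisBlade n 1 S)) = pgaPseudoscalar n

/-- The projective join `x ∨ y = (x* ∧ y*)^{-*}` determined by the projective dual `D`
(`D.symm` is the inverse dual). -/
def projJoin (n : ℕ) (D : GA n 1 ≃ₗ[ℝ] GA n 1) (x y : GA n 1) : GA n 1 :=
  D.symm (wedge n 1 (D x) (D y))

/-! ### Exterior algebra preliminaries -/

section Ext

variable {V : Type*} [AddCommGroup V] [Module ℝ V]

theorem pj_map_contract (f : V →ₗ[ℝ] V) (d : Module.Dual ℝ V) (z : ExteriorAlgebra ℝ V) :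
    ExteriorAlgebra.map f (contractLeft (d ∘ₗ f) z) =
      contractLeft d (ExteriorAlgebra.map f z) := by
  induction z using CliffordAlgebra.left_induction with
  | algebraMap r =>
    rw [contractLeft_algebraMap, map_zero]
    erw [AlgHom.commutes]
    exact (contractLeft_algebraMap _ _ _).symm
  | add x y hx hy => simp only [map_add, hx, hy]
  | ι_mul x m hx =>
    have h1 : ExteriorAlgebra.map f (ι 0 m) = ι 0 (f m) := ExteriorAlgebra.map_apply_ι f m
    rw [contractLeft_ι_mul, map_sub, map_smul, map_mul, map_mul, h1, hx, contractLeft_ι_mul]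
    rfl

theorem pj_map_transv (g : V →ₗ[ℝ] V) (b : Module.Dual ℝ V) (p : V)
    (hg : ∀ u, g u = u + b u • p) (z : ExteriorAlgebra ℝ V) :
    ExteriorAlgebra.map g z = z + ExteriorAlgebra.ι ℝ p * contractLeft b z := by
  induction z using CliffordAlgebra.left_induction with
  | algebraMap r =>
    rw [contractLeft_algebraMap, mul_zero, add_zero]
    exact AlgHom.commutes _ _
  | add x y hx hy => simp only [map_add, hx, hy, mul_add]; abel
  | ι_mul x m hx =>
    have h1 : ExteriorAlgebra.map g (ι 0 m) = ExteriorAlgebra.ι ℝ m + b m • ExteriorAlgebra.ι ℝ p := by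
      rw [← map_smul, ← map_add, ← hg]; exact ExteriorAlgebra.map_apply_ι g m
    have h2 : ExteriorAlgebra.ι ℝ m * ExteriorAlgebra.ι ℝ p
        = - (ExteriorAlgebra.ι ℝ p * ExteriorAlgebra.ι ℝ m) :=
      eq_neg_of_add_eq_zero_left (ExteriorAlgebra.ι_add_mul_swap m p)
    have h3 := ExteriorAlgebra.ι_sq_zero (R := ℝ) p
    rw [map_mul, h1, hx, contractLeft_ι_mul]
    change _ = ExteriorAlgebra.ι ℝ m * x + ExteriorAlgebra.ι ℝ p *
      (b m • x - ExteriorAlgebra.ι ℝ m * contractLeft b x)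
    rw [add_mul, mul_add, mul_add, smul_mul_assoc, smul_mul_assoc, ← mul_assoc, h2,
      ← mul_assoc (ExteriorAlgebra.ι ℝ p), h3, mul_sub, mul_smul_comm, ← mul_assoc]
    simp only [zero_mul, smul_zero, add_zero, neg_mul]
    abel

end Ext

section Blades

variable {m : ℕ}

/-- Basis vector of the exterior algebra. -/
def pjE (i : Fin m) : ExteriorAlgebra ℝ (Fin m → ℝ) := ExteriorAlgebra.ι ℝ (Pi.single i 1)

/-- Product of basis vectors along a list. -/
def pjB (l : List (Fin m)) : ExteriorAlgebra ℝ (Fin m → ℝ) := (l.map pjE).prod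

theorem pjB_nil : pjB ([] : List (Fin m)) = 1 := rfl

theorem pjB_cons (i : Fin m) (l : List (Fin m)) : pjB (i :: l) = pjE i * pjB l := by
  simp [pjB]

theorem pjB_snoc (i : Fin m) (l : List (Fin m)) : pjB (l ++ [i]) = pjB l * pjE i := by
  simp [pjB]

theorem pjE_sq (i : Fin m) : pjE i * pjE i = 0 := ExteriorAlgebra.ι_sq_zero _

theorem pjE_swap (i j : Fin m) : pjE i * pjE j = -(pjE j * pjE i) :=
  eq_neg_of_add_eq_zero_left (ExteriorAlgebra.ι_add_mul_swap _ _)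

theorem pjB_perm {l₁ l₂ : List (Fin m)} (h : l₁.Perm l₂) :
    ∃ ε : ℝ, ε * ε = 1 ∧ pjB l₁ = ε • pjB l₂ := by
  induction h with
  | nil => exact ⟨1, by norm_num, by simp⟩
  | cons x _ ih =>
    obtain ⟨ε, h1, h2⟩ := ih
    exact ⟨ε, h1, by rw [pjB_cons, pjB_cons, h2, mul_smul_comm]⟩
  | swap x y l =>
    refine ⟨-1, by norm_num, ?_⟩
    rw [pjB_cons, pjB_cons, pjB_cons, pjB_cons, ← mul_assoc, pjE_swap, ← mul_assoc]
    simp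
  | trans _ _ ih1 ih2 =>
    obtain ⟨ε, h1, h2⟩ := ih1
    obtain ⟨δ, h3, h4⟩ := ih2
    refine ⟨ε * δ, ?_, by rw [h2, h4, smul_smul]⟩
    calc ε * δ * (ε * δ) = (ε * ε) * (δ * δ) := by ring
      _ = 1 := by rw [h1, h3, one_mul]

/-- Euclidean dual functional of a vector. -/
def pjDot (w : Fin m → ℝ) : Module.Dual ℝ (Fin m → ℝ) := dotProductEquiv ℝ (Fin m) w

theorem pjDot_apply (w u : Fin m → ℝ) : pjDot w u = w ⬝ᵥ u := rfl

theorem pj_contract_cons (d : Module.Dual ℝ (Fin m → ℝ)) (i : Fin m)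
    (z : ExteriorAlgebra ℝ (Fin m → ℝ)) :
    contractLeft d (pjE i * z) = d (Pi.single i 1) • z - pjE i * contractLeft d z :=
  contractLeft_ι_mul _ _ _

theorem pj_contract_not_mem (i : Fin m) (l : List (Fin m)) (h : i ∉ l) :
    contractLeft (pjDot (Pi.single i 1)) (pjB l) = 0 := by
  induction l with
  | nil => exact contractLeft_one (Q := (0 : QuadraticForm ℝ (Fin m → ℝ))) _
  | cons j l ih =>
    rw [List.mem_cons, not_or] at h
    rw [pjB_cons, pj_contract_cons, ih h.2, pjDot_apply]
    simp [h.1]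

theorem pj_contract_head (i : Fin m) (l : List (Fin m)) (h : i ∉ l) :
    contractLeft (pjDot (Pi.single i 1)) (pjE i * pjB l) = pjB l := by
  rw [pj_contract_cons, pj_contract_not_mem i l h, pjDot_apply]
  simp

/-- Basis blade of a finset. -/
def pjS (S : Finset (Fin m)) : ExteriorAlgebra ℝ (Fin m → ℝ) := pjB (S.sort (· ≤ ·))

theorem pjS_of_list (l : List (Fin m)) (hl : l.Nodup) (S : Finset (Fin m))
    (h : ∀ x, x ∈ l ↔ x ∈ S) : ∃ ε : ℝ, ε * ε = 1 ∧ pjB l = ε • pjS S := by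
  apply pjB_perm
  rw [List.perm_ext_iff_of_nodup hl (Finset.sort_nodup _ _)]
  intro a; rw [h]; simp

theorem pjS_eq_list (l : List (Fin m)) (hl : l.Nodup) (S : Finset (Fin m))
    (h : ∀ x, x ∈ l ↔ x ∈ S) : ∃ ε : ℝ, ε * ε = 1 ∧ pjS S = ε • pjB l := by
  obtain ⟨ε, h1, h2⟩ := pjS_of_list l hl S h
  exact ⟨ε, h1, by rw [h2, smul_smul, h1, one_smul]⟩

theorem pjS_mul_mem (i : Fin m) (S : Finset (Fin m)) (h : i ∈ S) : pjS S * pjE i = 0 := by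
  obtain ⟨ε, -, h2⟩ := pjS_eq_list ((S.erase i).sort (· ≤ ·) ++ [i])
    (by simp [List.nodup_append]; grind) S (by intro x; simp; grind)
  rw [h2, pjB_snoc, smul_mul_assoc, mul_assoc, pjE_sq, mul_zero, smul_zero]

theorem pjS_mem_mul (i : Fin m) (S : Finset (Fin m)) (h : i ∈ S) : pjE i * pjS S = 0 := by
  obtain ⟨ε, -, h2⟩ := pjS_eq_list (i :: (S.erase i).sort (· ≤ ·))
    (by simp) S (by intro x; simp; grind)
  rw [h2, pjB_cons, mul_smul_comm, ← mul_assoc, pjE_sq, zero_mul, smul_zero]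

theorem pj_ι_eq_sum (w : Fin m → ℝ) : ExteriorAlgebra.ι ℝ w = ∑ i, w i • pjE i := by
  conv_lhs => rw [pi_eq_sum_univ' w]
  simp [pjE, map_sum]

theorem pjS_span (z : ExteriorAlgebra ℝ (Fin m → ℝ)) :
    z ∈ Submodule.span ℝ (Set.range (pjS (m := m))) := by
  induction z using CliffordAlgebra.left_induction with
  | algebraMap r =>
    rw [Algebra.algebraMap_eq_smul_one]
    refine Submodule.smul_mem _ _ (Submodule.subset_span ⟨∅, ?_⟩)
    simp [pjS, pjB_nil]
  | add x y hx hy => exact Submodule.add_mem _ hx hy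
  | ι_mul x w hx =>
    change ExteriorAlgebra.ι ℝ w * x ∈ _
    rw [pj_ι_eq_sum, Finset.sum_mul]
    refine Submodule.sum_mem _ fun i _ => ?_
    rw [smul_mul_assoc]
    refine Submodule.smul_mem _ _ ?_
    induction hx using Submodule.span_induction with
    | mem x h =>
      obtain ⟨S, rfl⟩ := h
      by_cases hi : i ∈ S
      · rw [pjS_mem_mul i S hi]; exact Submodule.zero_mem _
      · obtain ⟨ε, -, h2⟩ := pjS_of_list (i :: S.sort (· ≤ ·)) (by simp [hi]) (insert i S)
          (by simp)
        rw [pjB_cons] at h2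
        change pjE i * pjB _ ∈ _
        rw [h2]
        exact Submodule.smul_mem _ _ (Submodule.subset_span ⟨_, rfl⟩)
    | zero => rw [mul_zero]; exact Submodule.zero_mem _
    | add x y _ _ hx hy => rw [mul_add]; exact Submodule.add_mem _ hx hy
    | smul a x _ hx => rw [mul_smul_comm]; exact Submodule.smul_mem _ _ hx

theorem pj_dual_mul
    (D : ExteriorAlgebra ℝ (Fin m → ℝ) →ₗ[ℝ] ExteriorAlgebra ℝ (Fin m → ℝ))
    (I : ExteriorAlgebra ℝ (Fin m → ℝ)) (hI : I ≠ 0)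
    (h1 : ∀ S : Finset (Fin m), ∃ c : ℝ, D (pjS S) = c • pjS Sᶜ)
    (h2 : ∀ S : Finset (Fin m), pjS S * D (pjS S) = I)
    (z : ExteriorAlgebra ℝ (Fin m → ℝ)) (w : Fin m → ℝ) :
    D (z * ExteriorAlgebra.ι ℝ w) = contractLeft (pjDot w) (D z) := by
  have key : ∀ (S : Finset (Fin m)) (i : Fin m),
      D (pjS S * pjE i) = contractLeft (pjDot (Pi.single i 1)) (D (pjS S)) := by
    intro S i
    obtain ⟨c, hc⟩ := h1 S
    by_cases hi : i ∈ S
    · rw [pjS_mul_mem i S hi, map_zero, hc, map_smul, pjS, pj_contract_not_mem, smul_zero]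
      simp [hi]
    · obtain ⟨c', hc'⟩ := h1 (insert i S)
      obtain ⟨ε, hε, e1⟩ := pjS_of_list (S.sort (· ≤ ·) ++ [i])
        (by simp [List.nodup_append]; grind) (insert i S) (by intro x; simp; grind)
      obtain ⟨δ, hδ, e2⟩ := pjS_eq_list (i :: (insert i S)ᶜ.sort (· ≤ ·))
        (by simp) Sᶜ (by intro x; simp; grind)
      rw [pjB_snoc] at e1
      rw [pjB_cons] at e2
      change pjS S * pjE i = _ at e1
      change _ = δ • (pjE i * pjS (insert i S)ᶜ) at e2
      have e3 : pjS (insert i S) = ε • (pjS S * pjE i) := by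
        rw [e1, smul_smul, hε, one_smul]
      have a1 := h2 S
      have a2 := h2 (insert i S)
      rw [hc, e2, mul_smul_comm, mul_smul_comm, ← mul_assoc, smul_smul] at a1
      rw [hc', e3, mul_smul_comm, smul_mul_assoc, smul_smul] at a2
      have hz : pjS S * pjE i * pjS (insert i S)ᶜ ≠ 0 := by
        intro h0; rw [h0, smul_zero] at a1; exact hI a1.symm
      have hcc : c * δ = c' * ε := by
        have := a1.trans a2.symm
        exact smul_left_injective ℝ hz this
      rw [hc, e1, map_smul, hc', e2, map_smul, map_smul, pjS, pj_contract_head, smul_smul,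
        smul_smul, hcc, mul_comm]
      simp
  have key2 : ∀ i : Fin m,
      D (z * pjE i) = contractLeft (pjDot (Pi.single i 1)) (D z) := by
    intro i
    induction pjS_span z using Submodule.span_induction with
    | mem x h => obtain ⟨S, rfl⟩ := h; exact key S i
    | zero => simp
    | add x y _ _ hx hy => simp only [add_mul, map_add, hx, hy]
    | smul a x _ hx => simp only [smul_mul_assoc, map_smul, hx]
  have hw : pjDot w = ∑ i, w i • pjDot (Pi.single i 1) := by
    conv_lhs => rw [pi_eq_sum_univ' w]
    simp [pjDot, map_sum]
  rw [pj_ι_eq_sum, Finset.mul_sum, map_sum, hw, map_sum, LinearMap.sum_apply]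
  refine Finset.sum_congr rfl fun i _ => ?_
  rw [mul_smul_comm, map_smul, key2, map_smul, LinearMap.smul_apply]

theorem pj_dual_map
    (D : ExteriorAlgebra ℝ (Fin m → ℝ) →ₗ[ℝ] ExteriorAlgebra ℝ (Fin m → ℝ))
    (I : ExteriorAlgebra ℝ (Fin m → ℝ)) (hI : I ≠ 0)
    (h1 : ∀ S : Finset (Fin m), ∃ c : ℝ, D (pjS S) = c • pjS Sᶜ)
    (h2 : ∀ S : Finset (Fin m), pjS S * D (pjS S) = I)
    (f g : (Fin m → ℝ) →ₗ[ℝ] (Fin m → ℝ)) (v p : Fin m → ℝ)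
    (hg : ∀ u, g u = u + (v ⬝ᵥ u) • p) (hvp : v ⬝ᵥ p = -2)
    (hfg : ∀ w u, f w ⬝ᵥ g u = w ⬝ᵥ u)
    (z : ExteriorAlgebra ℝ (Fin m → ℝ)) :
    D (ExteriorAlgebra.map f z) = - ExteriorAlgebra.map g (D z) := by
  induction z using CliffordAlgebra.right_induction with
  | algebraMap r =>
    have hr : ExteriorAlgebra.map f (algebraMap ℝ _ r) = algebraMap ℝ _ r := AlgHom.commutes _ _
    have hone : (1 : ExteriorAlgebra ℝ (Fin m → ℝ)) = pjS ∅ := by simp [pjS, pjB_nil]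
    obtain ⟨c, hc⟩ := h1 ∅
    have hp : ExteriorAlgebra.ι ℝ p * D (pjS ∅) = 0 := by
      rw [hc, pj_ι_eq_sum, Finset.sum_mul]
      refine Finset.sum_eq_zero fun i _ => ?_
      rw [smul_mul_assoc, mul_smul_comm, pjS_mem_mul i _ (by simp), smul_zero, smul_zero]
    have hp2 : ExteriorAlgebra.ι ℝ p * contractLeft (pjDot v) (D (pjS ∅)) =
        (-2 : ℝ) • D (pjS ∅) := by
      have h := contractLeft_ι_mul (Q := (0 : QuadraticForm ℝ (Fin m → ℝ))) (d := pjDot v)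
        p (D (pjS ∅))
      have h' := congrArg (contractLeft (pjDot v)) hp
      rw [map_zero] at h'
      rw [pjDot_apply, hvp] at h
      exact (sub_eq_zero.1 (h.symm.trans h')).symm
    rw [hr, Algebra.algebraMap_eq_smul_one, map_smul, map_smul, hone,
      pj_map_transv g (pjDot v) p hg, hp2]
    module
  | add x y hx hy => simp only [map_add, hx, hy, neg_add]
  | mul_ι w x hx =>
    have h3 : ExteriorAlgebra.map f (ι 0 w) = ExteriorAlgebra.ι ℝ (f w) :=
      ExteriorAlgebra.map_apply_ι f w
    have h4 : pjDot (f w) ∘ₗ g = pjDot w := by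
      apply LinearMap.ext; intro u; exact hfg w u
    have h5 := pj_dual_mul D I hI h1 h2
    rw [map_mul, h3, h5, hx, map_neg, ← pj_map_contract, h4]
    exact congrArg (fun t => - ExteriorAlgebra.map g t) (h5 x w).symm

end Blades

/-! ### The Clifford side -/

section Cliff

variable {n : ℕ}

/-- Euclidean part of a vector. -/
def pjEuc (n : ℕ) (v : Fin (n + 1) → ℝ) : Fin (n + 1) → ℝ :=
  fun i => if (i : ℕ) < n then v i else 0

theorem pj_form (v : Fin (n + 1) → ℝ) : gaForm n 1 v = pjEuc n v ⬝ᵥ v := by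
  simp only [gaForm, QuadraticMap.weightedSumSquares_apply, dotProduct, pjEuc]
  refine Finset.sum_congr rfl fun i _ => ?_
  split_ifs <;> simp

theorem pjEuc_add (v w : Fin (n + 1) → ℝ) : pjEuc n (v + w) = pjEuc n v + pjEuc n w := by
  funext i; simp only [pjEuc, Pi.add_apply]; split_ifs <;> simp

theorem pjEuc_comm (v w : Fin (n + 1) → ℝ) : pjEuc n v ⬝ᵥ w = pjEuc n w ⬝ᵥ v := by
  simp only [dotProduct, pjEuc]
  refine Finset.sum_congr rfl fun i _ => ?_
  split_ifs <;> ring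

theorem pj_polar (v w : Fin (n + 1) → ℝ) :
    QuadraticMap.polar (gaForm n 1) v w = 2 * (pjEuc n v ⬝ᵥ w) := by
  rw [QuadraticMap.polar, pj_form, pj_form, pj_form, pjEuc_add, add_dotProduct, dotProduct_add,
    dotProduct_add, pjEuc_comm w v]
  ring

/-- The reflection in the unit vector `v`. -/
def pjRefl (n : ℕ) (v : Fin (n + 1) → ℝ) : (Fin (n + 1) → ℝ) →ₗ[ℝ] (Fin (n + 1) → ℝ) :=
  LinearMap.id - (2 : ℝ) • (pjDot (pjEuc n v)).smulRight v

theorem pjRefl_apply (v w : Fin (n + 1) → ℝ) :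
    pjRefl n v w = w - (2 * (pjEuc n v ⬝ᵥ w)) • v := by
  simp [pjRefl, pjDot_apply, smul_smul]

/-- The contragredient of the reflection in the unit vector `v`. -/
def pjCoRefl (n : ℕ) (v : Fin (n + 1) → ℝ) : (Fin (n + 1) → ℝ) →ₗ[ℝ] (Fin (n + 1) → ℝ) :=
  LinearMap.id + (pjDot v).smulRight ((-2 : ℝ) • pjEuc n v)

theorem pjCoRefl_apply (v u : Fin (n + 1) → ℝ) :
    pjCoRefl n v u = u + (v ⬝ᵥ u) • ((-2 : ℝ) • pjEuc n v) := by
  simp [pjCoRefl, pjDot_apply]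

theorem pj_refl_dot (v : Fin (n + 1) → ℝ) (hv : gaForm n 1 v = 1) (w u : Fin (n + 1) → ℝ) :
    pjRefl n v w ⬝ᵥ pjCoRefl n v u = w ⬝ᵥ u := by
  rw [pj_form] at hv
  rw [pjRefl_apply, pjCoRefl_apply]
  simp only [sub_dotProduct, dotProduct_add, smul_dotProduct, dotProduct_smul, smul_eq_mul,
    dotProduct_comm v (pjEuc n v), dotProduct_comm w (pjEuc n v), hv]
  ring

theorem pj_form_sub_smul (v w : Fin (n + 1) → ℝ) (hv : gaForm n 1 v = 1) :
    gaForm n 1 (pjRefl n v w) = gaForm n 1 w := by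
  have h : ∀ c : ℝ, gaForm n 1 (w + c • v) =
      gaForm n 1 w + c * c * gaForm n 1 v + c * (2 * (pjEuc n v ⬝ᵥ w)) := by
    intro c
    rw [QuadraticMap.map_add (gaForm n 1), QuadraticMap.map_smul, QuadraticMap.polar_smul_right,
      QuadraticMap.polar_comm, pj_polar]
    simp [smul_eq_mul]
  rw [pjRefl_apply, sub_eq_add_neg, ← neg_smul, h, hv]
  ring

theorem pj_sandwich (v w : Fin (n + 1) → ℝ) (hv : gaForm n 1 v = 1) :
    ι (gaForm n 1) v * (-ι (gaForm n 1) w) * ι (gaForm n 1) v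
      = ι (gaForm n 1) (pjRefl n v w) := by
  have h1 := ι_mul_ι_add_swap (Q := gaForm n 1) w v
  have h2 : ι (gaForm n 1) v * ι (gaForm n 1) v = 1 := by rw [ι_sq_scalar, hv, map_one]
  rw [QuadraticMap.polar_comm, pj_polar] at h1
  rw [mul_neg, neg_mul, mul_assoc, eq_sub_of_add_eq h1, mul_sub, ← mul_assoc, h2, one_mul,
    pjRefl_apply, map_sub, map_smul, ← Algebra.commutes, ← Algebra.smul_def]
  abel

theorem pj_ext_ι_mul (w : Fin (n + 1) → ℝ) (z : GA n 1) :
    gaToExt n 1 (ι (gaForm n 1) w * z) = ExteriorAlgebra.ι ℝ w * gaToExt n 1 z -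
      contractLeft (QuadraticMap.associated (R := ℝ) (-gaForm n 1) w) (gaToExt n 1 z) :=
  changeForm_ι_mul changeForm.associated_neg_proof _ _

theorem pj_ext_algebraMap (r : ℝ) :
    gaToExt n 1 (algebraMap ℝ _ r) = algebraMap ℝ _ r :=
  changeForm_algebraMap changeForm.associated_neg_proof _

theorem pj_ext_one : gaToExt n 1 1 = 1 := changeForm_one changeForm.associated_neg_proof

theorem pj_ext_ι (w : Fin (n + 1) → ℝ) :
    gaToExt n 1 (ι (gaForm n 1) w) = ExteriorAlgebra.ι ℝ w :=
  changeForm_ι changeForm.associated_neg_proof _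

/-- The action of one unit vector. -/
def pjAct (n : ℕ) (v : Fin (n + 1) → ℝ) (z : GA n 1) : GA n 1 :=
  ι (gaForm n 1) v * involute z * ι (gaForm n 1) v

theorem pj_ext_act (v : Fin (n + 1) → ℝ) (hv : gaForm n 1 v = 1) (z : GA n 1) :
    gaToExt n 1 (pjAct n v z) = ExteriorAlgebra.map (pjRefl n v) (gaToExt n 1 z) := by
  have hvv : ι (gaForm n 1) v * ι (gaForm n 1) v = 1 := by rw [ι_sq_scalar, hv, map_one]
  induction z using CliffordAlgebra.left_induction with
  | algebraMap r =>
    rw [pjAct, AlgHom.commutes, ← Algebra.commutes, mul_assoc, hvv, mul_one, pj_ext_algebraMap,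
      AlgHom.commutes]
  | add x y hx hy =>
    have : pjAct n v (x + y) = pjAct n v x + pjAct n v y := by
      simp only [pjAct, map_add, mul_add, add_mul]
    rw [this, map_add, hx, hy, map_add, map_add]
  | ι_mul x w hx =>
    have h1 : pjAct n v (ι (gaForm n 1) w * x) =
        ι (gaForm n 1) (pjRefl n v w) * pjAct n v x := by
      rw [← pj_sandwich v w hv]
      simp only [pjAct, map_mul, involute_ι]
      simp only [mul_assoc]
      rw [← mul_assoc (ι (gaForm n 1) v) (ι (gaForm n 1) v), hvv, one_mul]
    have h2 : QuadraticMap.associated (R := ℝ) (-gaForm n 1) (pjRefl n v w) ∘ₗ pjRefl n v =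
        QuadraticMap.associated (R := ℝ) (-gaForm n 1) w := by
      apply LinearMap.ext; intro u
      simp only [LinearMap.comp_apply, QuadraticMap.associated_apply, neg_apply,
        ← map_add, pj_form_sub_smul _ _ hv]
    rw [h1, pj_ext_ι_mul, hx, ← pj_map_contract, h2, pj_ext_ι_mul, map_sub, map_mul,
      ExteriorAlgebra.map_apply_ι]

theorem pj_ext_basisBlade (S : Finset (Fin (n + 1))) :
    gaToExt n 1 (basisBlade n 1 S) = pjS S := by
  unfold basisBlade pjS
  generalize S.sort (· ≤ ·) = l
  induction l with
  | nil => exact pj_ext_one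
  | cons i l ih =>
    rw [pjB_cons, ← ih]
    simp only [List.map_cons, bladeList, List.foldr_cons, wedge, LinearEquiv.apply_symm_apply,
      pj_ext_ι]
    rfl

theorem pj_ext_wedge (x y : GA n 1) :
    gaToExt n 1 (wedge n 1 x y) = gaToExt n 1 x * gaToExt n 1 y :=
  LinearEquiv.apply_symm_apply _ _

theorem pj_act_join (D : GA n 1 ≃ₗ[ℝ] GA n 1) (hD : IsProjDual n D)
    (v : Fin (n + 1) → ℝ) (hv : gaForm n 1 v = 1) (x y : GA n 1) :
    pjAct n v (projJoin n D x y) = - projJoin n D (pjAct n v x) (pjAct n v y) := by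
  set D' : ExteriorAlgebra ℝ (Fin (n + 1) → ℝ) →ₗ[ℝ] ExteriorAlgebra ℝ (Fin (n + 1) → ℝ) :=
    (gaToExt n 1).toLinearMap ∘ₗ D.toLinearMap ∘ₗ (gaToExt n 1).symm.toLinearMap with hD'
  have hDD : ∀ z, D' (gaToExt n 1 z) = gaToExt n 1 (D z) := by
    intro z; simp [hD']
  have hI : gaToExt n 1 (pgaPseudoscalar n) ≠ 0 := by
    have h := (hD ∅).2
    have h1 : basisBlade n 1 ∅ = 1 := by simp [basisBlade, bladeList]
    rw [← h, h1, pj_ext_wedge, pj_ext_one, one_mul]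
    simp
  have h1 : ∀ S : Finset (Fin (n + 1)), ∃ c : ℝ, D' (pjS S) = c • pjS Sᶜ := by
    intro S
    obtain ⟨c, hc⟩ := (hD S).1
    exact ⟨c, by rw [← pj_ext_basisBlade, hDD, hc, map_smul, pj_ext_basisBlade]⟩
  have h2 : ∀ S : Finset (Fin (n + 1)),
      pjS S * D' (pjS S) = gaToExt n 1 (pgaPseudoscalar n) := by
    intro S
    rw [← (hD S).2, pj_ext_wedge, ← hDD, pj_ext_basisBlade]
  have hact : ∀ z, gaToExt n 1 (D (pjAct n v z)) =
      - ExteriorAlgebra.map (pjCoRefl n v) (gaToExt n 1 (D z)) := by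
    intro z
    rw [← hDD, pj_ext_act v hv, ← hDD]
    refine pj_dual_map D' _ hI h1 h2 _ _ v _ (pjCoRefl_apply v) ?_ (pj_refl_dot v hv) _
    rw [dotProduct_smul, dotProduct_comm, ← pj_form, hv]; simp
  apply D.injective
  apply (gaToExt n 1).injective
  rw [hact, map_neg, map_neg, projJoin, projJoin, LinearEquiv.apply_symm_apply,
    LinearEquiv.apply_symm_apply, pj_ext_wedge, pj_ext_wedge, hact, hact, neg_mul_neg, map_mul]

theorem pj_involute_versor (l : List (Fin (n + 1) → ℝ)) :
    involute (versor n 1 l) = (-1 : ℝ) ^ l.length • versor n 1 l :=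
  involute_prod_map_ι l

theorem pj_pin_cons (v : Fin (n + 1) → ℝ) (l : List (Fin (n + 1) → ℝ)) (x : GA n 1) :
    pinAction n 1 (v :: l) x = pjAct n v (pinAction n 1 l x) := by
  have h1 : versor n 1 (v :: l) = ι (gaForm n 1) v * versor n 1 l := by simp [versor]
  have h2 : (-1 : ℝ) ^ l.length * (-1 : ℝ) ^ l.length = 1 := by
    rw [← mul_pow]; simp
  simp only [pinAction, pjAct, h1, reverse.map_mul, reverse_ι, map_mul, pj_involute_versor,
    List.length_cons, Function.iterate_succ_apply']
  rw [← reverse_involute_commute.eq, pj_involute_versor, map_smul]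
  simp only [smul_mul_assoc, mul_smul_comm, smul_smul, h2, one_smul, mul_assoc]

theorem pj_pin_join (D : GA n 1 ≃ₗ[ℝ] GA n 1) (hD : IsProjDual n D)
    (l : List (Fin (n + 1) → ℝ)) (hl : IsUnitVecList n 1 l) (x y : GA n 1) :
    pinAction n 1 l (projJoin n D x y) =
      (-1 : ℝ) ^ l.length • projJoin n D (pinAction n 1 l x) (pinAction n 1 l y) := by
  induction l with
  | nil => simp [pinAction, versor]
  | cons v l ih =>
    have hsm : ∀ (c : ℝ) z, pjAct n v (c • z) = c • pjAct n v z := by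
      intro c z; simp [pjAct]
    rw [pj_pin_cons, pj_pin_cons, pj_pin_cons,
      ih (fun w hw => hl w (List.mem_cons_of_mem _ hw)), hsm,
      pj_act_join D hD v (hl v List.mem_cons_self), List.length_cons, pow_succ]
    simp

end Cliff

/-- In `G_{n,0,1}`, the projective join `x ∨ y = (x* ∧ y*)^{−*}` is
equivariant to the sandwich action of `Spin(n,0,1)`: `u[x ∨ y] = u[x] ∨ u[y]` for every
`u ∈ Spin(n,0,1)` (a product of an even number of unit vectors). -/
theorem projective_join_spin_equivariant (n : ℕ)
    (D : GA n 1 ≃ₗ[ℝ] GA n 1) (hD : IsProjDual n D)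
    (l : List (Fin (n + 1) → ℝ)) (hl : IsUnitVecList n 1 l) (hev : Even l.length)
    (x y : GA n 1) :
    pinAction n 1 l (projJoin n D x y) =
      projJoin n D (pinAction n 1 l x) (pinAction n 1 l y) := by
  rw [pj_pin_join D hD l hl, hev.neg_one_pow, one_smul]

end
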